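/- arXiv:math/9508206 — 2 statements merged into one kernel-verified Lean document; each statement's English description precedes it below -/
import Mathlib

section
/- Let I be a countable partially ordered set, ζ an initial segment of I, and X ∈ IPe(ζ). Then for every initial segment ξ of I with ξ ⊆ ζ, the projection X↾ξ belongs to IPe(ξ). -/
open Set

abbrev Cantor : Type := ℕ → Bool

section
variable {I : Type}

/-- Restriction of a point of `D^η` to `D^ξ` (for `ξ ⊆ η`). -/
def restrictFn {ξ η : Set I} (h : ξ ⊆ η) (x : ↥η → Cantor) : ↥ξ → Cantor :=
  fun j => x ⟨j.1, h j.2⟩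

/-- Projection `X↾ξ` of a set `X ⊆ D^η`. -/
def resSet {ξ η : Set I} (h : ξ ⊆ η) (X : Set (↥η → Cantor)) : Set (↥ξ → Cantor) :=
  restrictFn h '' X

/-- Inverse projection `Y↾⁻¹η` of a set `Y ⊆ D^ξ`. -/
def resPre {ξ η : Set I} (h : ξ ⊆ η) (Y : Set (↥ξ → Cantor)) : Set (↥η → Cantor) :=
  {y | restrictFn h y ∈ Y}

/-- `A` is (relatively) open in `B`. -/
def RelOpen {α : Type*} [TopologicalSpace α] (A B : Set α) : Prop :=
  ∃ U, IsOpen U ∧ A = U ∩ B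

/-- `A` is (relatively) closed in `B`. -/
def RelClosed {α : Type*} [TopologicalSpace α] (A B : Set α) : Prop :=
  ∃ U, IsClosed U ∧ A = U ∩ B

/-- `A` is (relatively) clopen in `B`. -/
def RelClopen {α : Type*} [TopologicalSpace α] (A B : Set α) : Prop :=
  RelOpen A B ∧ RelClosed A B

open Classical in
/-- The union `x ∪ y` of two partial points agreeing on the common domain. -/
noncomputable def glue {ξ η : Set I} (x : ↥ξ → Cantor) (y : ↥η → Cantor) :
    ↥(ξ ∪ η) → Cantor :=
  fun j => if h : j.1 ∈ ξ then x ⟨j.1, h⟩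
           else y ⟨j.1, ((Set.mem_union j.1 ξ η).mp j.2).resolve_left h⟩

variable [PartialOrder I]

/-- `[<i]`. -/
def seg (i : I) : Set I := {j | j < i}

/-- `[≤i]`. -/
def segLe (i : I) : Set I := {j | j ≤ i}

/-- `[≯i]`. -/
def segNG (i : I) : Set I := {j | ¬ i < j}

lemma seg_subset {ζ : Set I} (hζ : IsLowerSet ζ) {i : I} (hi : i ∈ ζ) : seg i ⊆ ζ :=
  fun _ hj => hζ (le_of_lt hj) hi

lemma segLe_subset {ζ : Set I} (hζ : IsLowerSet ζ) {i : I} (hi : i ∈ ζ) : segLe i ⊆ ζ :=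
  fun _ hj => hζ hj hi

lemma isLowerSet_segLe (i : I) : IsLowerSet (segLe i) :=
  fun _ _ hba ha => le_trans hba ha

lemma seg_subset_segLe (i : I) : seg i ⊆ segLe i :=
  fun _ hj => le_of_lt hj

lemma mem_segLe_self (i : I) : i ∈ segLe i := le_refl i

/-- `D_{Xz}(i) = {x(i) : x ∈ X, x↾(<i) = z}`. -/
def Dxz {ζ : Set I} (X : Set (↥ζ → Cantor)) {i : I} (hi : i ∈ ζ) (h : seg i ⊆ ζ)
    (z : ↥(seg i) → Cantor) : Set Cantor :=
  {c | ∃ x ∈ X, restrictFn h x = z ∧ x ⟨i, hi⟩ = c}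

/-- Pre-conditions `IPe(ζ)`. -/
def IPe (ζ : Set I) (hζ : IsLowerSet ζ) (X : Set (↥ζ → Cantor)) : Prop :=
  -- P-1
  (IsClosed X ∧ X.Nonempty) ∧
  -- P-2
  (∀ (i : I) (hi : i ∈ ζ), ∀ z ∈ resSet (seg_subset hζ hi) X,
      Perfect (Dxz X hi (seg_subset hζ hi) z)) ∧
  -- P-3
  (∀ (i : I) (hi : i ∈ ζ), ∀ G : Set Cantor, IsOpen G →
      RelOpen
        ({z | ∃ x ∈ X, x ⟨i, hi⟩ ∈ G ∧ restrictFn (seg_subset hζ hi) x = z} :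
          Set (↥(seg i) → Cantor))
        (resSet (seg_subset hζ hi) X)) ∧
  -- P-4
  (∀ ξ η : Set I, IsLowerSet ξ → IsLowerSet η → ∀ (hξ : ξ ⊆ ζ) (hη : η ⊆ ζ),
      ∀ x ∈ resSet hξ X, ∀ y ∈ resSet hη X,
        restrictFn (Set.inter_subset_left : ξ ∩ η ⊆ ξ) x =
          restrictFn (Set.inter_subset_right : ξ ∩ η ⊆ η) y →
        glue x y ∈ resSet (Set.union_subset hξ hη) X)

/-- `stem(A)`: the length of the longest common initial segment of members of `A`. -/
noncomputable def stem (A : Set Cantor) : ℕ :=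
  sInf {n | ∃ a ∈ A, ∃ b ∈ A, a n ≠ b n}

/-- `Spl(A,e)` for `A ⊆ D`. -/
def SplD (A : Set Cantor) (e : Bool) : Set Cantor :=
  {a ∈ A | a (stem A) = e}

/-- `Spl(X,i,e)` for `X ⊆ D^ζ`. -/
def Spl {ζ : Set I} (hζ : IsLowerSet ζ) (X : Set (↥ζ → Cantor)) {i : I} (hi : i ∈ ζ)
    (e : Bool) : Set (↥ζ → Cantor) :=
  {x ∈ X |
    x ⟨i, hi⟩ ∈
      SplD (Dxz X hi (seg_subset hζ hi) (restrictFn (seg_subset hζ hi) x)) e}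

/-- A `ζ`-admissible function: `Φ : ω → ζ` taking each value of `ζ` infinitely often. -/
def Admissible (ζ : Set I) (Φ : ℕ → I) : Prop :=
  (∀ n, Φ n ∈ ζ) ∧ ∀ i ∈ ζ, ∀ N : ℕ, ∃ n, N ≤ n ∧ Φ n = i

/-- The sets `X_Φ[u]` for finite binary sequences `u`. -/
def XPhi {ζ : Set I} (hζ : IsLowerSet ζ) (Φ : ℕ → I) (hΦ : ∀ n, Φ n ∈ ζ)
    (X : Set (↥ζ → Cantor)) : (m : ℕ) → (Fin m → Bool) → Set (↥ζ → Cantor)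
  | 0, _ => X
  | m + 1, u =>
      Spl hζ (XPhi hζ Φ hΦ X m (fun k => u k.castSucc)) (hΦ m) (u (Fin.last m))

/-- `X` is shrinkable: each `X_Φ[a]` is a singleton. -/
def Shrinkable {ζ : Set I} (hζ : IsLowerSet ζ) (X : Set (↥ζ → Cantor)) : Prop :=
  ∀ (Φ : ℕ → I) (hΦ : Admissible ζ Φ) (a : ℕ → Bool),
    ∃ x, (⋂ m : ℕ, XPhi hζ Φ hΦ.1 X m (fun k => a k.1)) = {x}

/-- Conditions `Pe(ζ)`: shrinkable pre-conditions. -/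
def Pe (ζ : Set I) (hζ : IsLowerSet ζ) (X : Set (↥ζ → Cantor)) : Prop :=
  IPe ζ hζ X ∧ Shrinkable hζ X

/-- `Perf = Pe(I)`. -/
def Perf (X : Set (↥(Set.univ : Set I) → Cantor)) : Prop :=
  Pe Set.univ isLowerSet_univ X

/-- The initial segments `ξ[u,v]`. -/
def xiUV (Φ : ℕ → I) : (m : ℕ) → (Fin m → Bool) → (Fin m → Bool) → Set I
  | 0, _, _ => Set.univ
  | m + 1, u, v =>
      if u (Fin.last m) = v (Fin.last m) then
        xiUV Φ m (fun k => u k.castSucc) (fun k => v k.castSucc)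
      else
        xiUV Φ m (fun k => u k.castSucc) (fun k => v k.castSucc) ∩ segNG (Φ m)

/-- A `Φ`-splitting system of order `m`. -/
def SplittingSystem (Φ : ℕ → I) (m : ℕ)
    (X : (n : ℕ) → (Fin n → Bool) → Set (↥(Set.univ : Set I) → Cantor)) : Prop :=
  (∀ n, n ≤ m → ∀ u : Fin n → Bool, Perf (X n u)) ∧
  -- S-1
  (∀ n, n < m → ∀ (u : Fin n → Bool) (e : Bool),
      X (n + 1) (Fin.snoc u e) ⊆
        Spl isLowerSet_univ (X n u) (Set.mem_univ (Φ n)) e) ∧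
  -- S-2
  (∀ n, n ≤ m → ∀ u v : Fin n → Bool,
      resSet (Set.subset_univ (xiUV Φ n u v)) (X n u) =
        resSet (Set.subset_univ (xiUV Φ n u v)) (X n v)) ∧
  -- S-3
  (∀ n, n ≤ m → ∀ u v : Fin n → Bool, ∀ i : I, i ∉ xiUV Φ n u v →
      resSet (Set.subset_univ (segLe i)) (X n u) ∩
        resSet (Set.subset_univ (segLe i)) (X n v) = ∅)

/-- `F` is reducible to `ξ` on `X`. -/
def Reducible {β : Type*} (F : (↥(Set.univ : Set I) → Cantor) → β) (ξ : Set I)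
    (X : Set (↥(Set.univ : Set I) → Cantor)) : Prop :=
  ∀ x ∈ X, ∀ y ∈ X,
    restrictFn (Set.subset_univ ξ) x = restrictFn (Set.subset_univ ξ) y → F x = F y

/-- `F` captures `i` on `X`. -/
def Captures {β : Type*} (F : (↥(Set.univ : Set I) → Cantor) → β) (i : I)
    (X : Set (↥(Set.univ : Set I) → Cantor)) : Prop :=
  ∀ x ∈ X, ∀ y ∈ X, F x = F y → x ⟨i, Set.mem_univ i⟩ = y ⟨i, Set.mem_univ i⟩

/-- Borel sets of finite level: level `0` = closed sets, level `n+1` = countable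
unions or countable intersections of sets of level `n`. -/
def BorelLevel {α : Type*} [TopologicalSpace α] : ℕ → Set (Set α)
  | 0 => {C | IsClosed C}
  | n + 1 =>
      {S | (∃ f : ℕ → Set α, (∀ k, f k ∈ BorelLevel n) ∧ S = ⋃ k, f k) ∨
           (∃ f : ℕ → Set α, (∀ k, f k ∈ BorelLevel n) ∧ S = ⋂ k, f k)}

end

theorem continuous_restrictFn {I : Type} {ξ η : Set I} (h : ξ ⊆ η) :
    Continuous (restrictFn h) :=
  continuous_pi fun j => continuous_apply (⟨j.1, h j.2⟩ : ↥η)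

theorem resSet_resSet {I : Type} {ξ η ζ : Set I} (h : ξ ⊆ η) (h' : η ⊆ ζ)
    (X : Set (↥ζ → Cantor)) : resSet h (resSet h' X) = resSet (h.trans h') X :=
  Set.image_image _ _ _

theorem Dxz_resSet {I : Type} [PartialOrder I] {ξ ζ : Set I} (hsub : ξ ⊆ ζ)
    (X : Set (↥ζ → Cantor)) {i : I} (hi : i ∈ ξ) (h : seg i ⊆ ξ) (z : ↥(seg i) → Cantor) :
    Dxz (resSet hsub X) hi h z = Dxz X (hsub hi) (h.trans hsub) z := by
  ext c
  exact Set.exists_mem_image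

theorem stmt0 (I : Type) [PartialOrder I] [Countable I]
    (ζ : Set I) (hζ : IsLowerSet ζ)
    (X : Set (↥ζ → Cantor)) (hX : IPe ζ hζ X)
    (ξ : Set I) (hξ : IsLowerSet ξ) (hsub : ξ ⊆ ζ) :
    IPe ξ hξ (resSet hsub X) := by
  obtain ⟨⟨hclosed, hne⟩, hperf, hopen, hglue⟩ := hX
  refine ⟨⟨?_, hne.image _⟩, ?_, ?_, ?_⟩
  · exact (hclosed.isCompact.image (continuous_restrictFn hsub)).isClosed
  · intro i hi z hz
    rw [resSet_resSet] at hz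
    rw [Dxz_resSet]
    exact hperf i (hsub hi) z hz
  · intro i hi G hG
    rw [resSet_resSet]
    convert hopen i (hsub hi) G hG using 1
    ext z
    exact Set.exists_mem_image
  · intro σ τ hσ hτ hσξ hτξ x hx y hy hxy
    rw [resSet_resSet] at hx hy ⊢
    exact hglue σ τ hσ hτ (hσξ.trans hsub) (hτξ.trans hsub) x hx y hy hxy
end

section
/- Suppose ξ, η, ζ are initial segments of I with ξ ∪ η ⊆ ζ, X ∈ IPe(ζ), Y ⊆ X↾η, and Z = X ∩ (Y↾⁻¹ζ). Then Z↾ξ = (X↾ξ) ∩ ((Y↾(ξ∩η))↾⁻¹ξ). -/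
open Set

lemma restrictFn_glue_left {I : Type} {ξ η : Set I} (x : ↥ξ → Cantor) (y : ↥η → Cantor) :
    restrictFn (Set.subset_union_left : ξ ⊆ ξ ∪ η) (glue x y) = x := by
  funext j
  simp [restrictFn, glue]

lemma restrictFn_glue_right {I : Type} {ξ η : Set I} {x : ↥ξ → Cantor} {y : ↥η → Cantor}
    (h : restrictFn (Set.inter_subset_left : ξ ∩ η ⊆ ξ) x =
      restrictFn (Set.inter_subset_right : ξ ∩ η ⊆ η) y) :
    restrictFn (Set.subset_union_right : η ⊆ ξ ∪ η) (glue x y) = y := by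
  funext j
  by_cases hj : j.1 ∈ ξ
  · simpa [restrictFn, glue, hj] using congrFun h ⟨j.1, hj, j.2⟩
  · simp [restrictFn, glue, hj]

theorem stmt1 (I : Type) [PartialOrder I] [Countable I]
    (ξ η ζ : Set I) (hξ : IsLowerSet ξ) (hη : IsLowerSet η) (hζ : IsLowerSet ζ)
    (hsub : ξ ∪ η ⊆ ζ)
    (X : Set (↥ζ → Cantor)) (hX : IPe ζ hζ X)
    (Y : Set (↥η → Cantor)) (hY : Y ⊆ resSet (Set.subset_union_right.trans hsub) X)
    (Z : Set (↥ζ → Cantor))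
    (hZ : Z = X ∩ resPre (Set.subset_union_right.trans hsub) Y) :
    resSet (Set.subset_union_left.trans hsub) Z =
      resSet (Set.subset_union_left.trans hsub) X ∩
        resPre (Set.inter_subset_left : ξ ∩ η ⊆ ξ)
          (resSet (Set.inter_subset_right : ξ ∩ η ⊆ η) Y) := by
  subst hZ
  apply Set.Subset.antisymm
  · rintro _ ⟨x, ⟨hxX, hxY⟩, rfl⟩
    exact ⟨⟨x, hxX, rfl⟩, _, hxY, rfl⟩
  · rintro x ⟨hxX, y, hyY, hyx⟩
    obtain ⟨w, hwX, hw⟩ := hX.2.2.2 ξ η hξ hη (Set.subset_union_left.trans hsub)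
      (Set.subset_union_right.trans hsub) x hxX y (hY hyY) hyx.symm
    refine ⟨w, ⟨hwX, ?_⟩, ?_⟩
    · have hwy : restrictFn (Set.subset_union_right.trans hsub) w = y := by
        rw [← restrictFn_glue_right hyx.symm, ← hw]
        rfl
      rwa [resPre, Set.mem_ofPred_eq, hwy]
    · rw [← restrictFn_glue_left x y, ← hw]
      rfl
end
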